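/- Define d*_μ(U,V) = inf_{x∈ℝ} ν_μ(e^{ix} U V⁻¹). Then d*_μ is a pseudo-metric on n×n unitary matrices: nonnegative, symmetric, d*_μ(U,U) = 0, and it satisfies the triangle inequality; moreover d*_μ(U,V) = 0 if and only if V = e^{ix} U for some real x. -/

import Mathlib

open Complex Matrix

noncomputable def absArgs {m : Type*} [Fintype m] [DecidableEq m]
    (M : Matrix m m ℂ) : List ℝ :=
  ((M.charpoly.roots).map (fun z => |Complex.arg z|)).sort (· ≥ ·)

noncomputable def nu {n : ℕ} (μ : Fin n → ℝ) (M : Matrix (Fin n) (Fin n) ℂ) : ℝ :=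
  ∑ j : Fin n, μ j * (absArgs M).getD j 0

noncomputable def nuStar {n : ℕ} (μ : Fin n → ℝ) (M : Matrix (Fin n) (Fin n) ℂ) : ℝ :=
  ⨅ x : ℝ, nu μ (Complex.exp (x * Complex.I) • M)

lemma ds_le {n : ℕ} (μ a : Fin n → ℝ) (hμ : Antitone μ) (ha : Antitone a)
    (Z : Matrix (Fin n) (Fin n) ℂ) (hZ : Z ∈ unitaryGroup (Fin n) ℂ) :
    ∑ j, μ j * ∑ i, ‖Z i j‖ ^ 2 * a i ≤ ∑ j, μ j * a j := by
  have hcol : ∀ j, ∑ i, ‖Z i j‖ ^ 2 = 1 := by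
    intro j
    have := congrFun (congrFun (mem_unitaryGroup_iff'.1 hZ) j) j
    rw [Matrix.mul_apply] at this
    simp [star_apply, Complex.conj_mul'] at this
    exact_mod_cast this
  have hrow : ∀ i, ∑ j, ‖Z i j‖ ^ 2 = 1 := by
    intro j
    have := congrFun (congrFun (mem_unitaryGroup_iff.1 hZ) j) j
    rw [Matrix.mul_apply] at this
    simp [star_apply, Complex.mul_conj'] at this
    exact_mod_cast this
  have hM : (Matrix.of fun i j => ‖Z i j‖ ^ 2) ∈ doublyStochastic ℝ (Fin n) := by
    rw [mem_doublyStochastic_iff_sum]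
    exact ⟨fun i j => by simp, by simpa using hrow, by simpa using hcol⟩
  obtain ⟨w, hw0, hw1, hw⟩ := exists_eq_sum_perm_of_mem_doublyStochastic hM
  have hZ' : ∀ i j, ‖Z i j‖ ^ 2 = ∑ σ, w σ * (if σ i = j then 1 else 0) := by
    intro i j
    have := congrFun (congrFun hw i) j
    rw [Matrix.sum_apply] at this
    simp only [Matrix.of_apply] at this
    rw [← this]
    refine Finset.sum_congr rfl fun σ _ => ?_
    simp [Equiv.Perm.permMatrix, PEquiv.toMatrix_apply, eq_comm]
  have e : ∑ j, μ j * ∑ i, ‖Z i j‖ ^ 2 * a i = ∑ σ, w σ * ∑ i, μ (σ i) * a i := by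
    simp only [hZ', Finset.mul_sum, Finset.sum_mul]
    rw [Finset.sum_comm]
    have : ∀ i, ∑ j, ∑ σ : Equiv.Perm (Fin n), μ j * (w σ * (if σ i = j then 1 else 0) * a i)
        = ∑ σ : Equiv.Perm (Fin n), w σ * (μ (σ i) * a i) := by
      intro i
      rw [Finset.sum_comm]
      refine Finset.sum_congr rfl fun σ _ => ?_
      rw [Finset.sum_eq_single (σ i)]
      · simp; ring
      · intro j _ hj
        rw [if_neg (Ne.symm hj)]; simp
      · simp
    simp only [this]
    rw [Finset.sum_comm]
  rw [e]
  calc _ ≤ ∑ σ, w σ * ∑ i, μ i * a i := by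
        refine Finset.sum_le_sum fun σ _ => mul_le_mul_of_nonneg_left ?_ (hw0 σ)
        exact Monovary.sum_comp_perm_mul_le_sum_mul (hμ.monovary ha)
    _ = _ := by rw [← Finset.sum_mul, hw1, one_mul]

lemma nu_eq {n : ℕ} (μ : Fin n → ℝ) (X : Matrix (Fin n) (Fin n) ℂ) (hX : X ∈ unitaryGroup (Fin n) ℂ)
    (l : Fin n → ℂ) (hl : Antitone fun i => |(l i).arg|) :
    nu μ (X * diagonal l * star X) = ∑ j, μ j * |(l j).arg| := by
  have hc : (X * diagonal l * star X).charpoly = (diagonal l).charpoly := by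
    have h1 : X * star X = 1 := mem_unitaryGroup_iff.1 hX
    have h2 : star X * X = 1 := mem_unitaryGroup_iff'.1 hX
    have h3 := Matrix.charpoly_units_conj ⟨X, star X, h1, h2⟩ (diagonal l)
    rwa [← Matrix.coe_units_inv] at h3
  have hr : (X * diagonal l * star X).charpoly.roots = Multiset.map l Finset.univ.val := by
    rw [hc, Matrix.charpoly_diagonal]
    exact Polynomial.roots_multiset_prod_X_sub_C (Multiset.map l Finset.univ.val) ▸ by
      simp [Finset.prod, Multiset.map_map, Function.comp_def]
  have hs : absArgs (X * diagonal l * star X) = List.ofFn fun i => |(l i).arg| := by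
    unfold absArgs
    rw [hr, Multiset.map_map, Fin.univ_val_map]
    rw [Multiset.coe_sort]
    apply List.mergeSort_of_pairwise
    rw [List.pairwise_ofFn]
    intro i j hij
    simpa using hl hij.le
  unfold nu
  rw [hs]
  refine Finset.sum_congr rfl fun j _ => ?_
  simp [List.getD]

lemma diag_exists {n : ℕ} (W : Matrix (Fin n) (Fin n) ℂ) (hW : W ∈ unitaryGroup (Fin n) ℂ) :
    ∃ X ∈ unitaryGroup (Fin n) ℂ, ∃ l : Fin n → ℂ, W = X * diagonal l * star X ∧
      (∀ i, ‖l i‖ = 1) ∧ Antitone fun i => |(l i).arg| := by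
  have hW1 : W * star W = 1 := mem_unitaryGroup_iff.1 hW
  have hW2 : star W * W = 1 := mem_unitaryGroup_iff'.1 hW
  obtain ⟨X, hX, l, hXl⟩ : ∃ X ∈ unitaryGroup (Fin n) ℂ, ∃ l : Fin n → ℂ,
      star X * W * X = diagonal l := by
    obtain ⟨c, hc1, hc⟩ : ∃ c : ℂ, ‖c‖ = 1 ∧ IsUnit (c • (1 : Matrix (Fin n) (Fin n) ℂ) - W) := by
      have hinf : (Metric.sphere (0:ℂ) 1).Infinite := by
        apply Set.Infinite.of_image Complex.arg
        apply (Set.Ioc_infinite (by linarith [Real.pi_pos] : -Real.pi < Real.pi)).mono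
        intro t ht
        refine ⟨exp (t * I), by simp [Complex.norm_exp_ofReal_mul_I], ?_⟩
        rw [Complex.arg_exp_mul_I]
        rw [toIocMod_eq_self]
        refine ⟨ht.1, ht.2.trans (by linarith)⟩
      obtain ⟨c, hc, hc2⟩ := hinf.exists_notMem_finset W.charpoly.roots.toFinset
      refine ⟨c, by simpa using hc, ?_⟩
      rw [Matrix.isUnit_iff_isUnit_det, isUnit_iff_ne_zero]
      rw [Multiset.mem_toFinset, Polynomial.mem_roots (Matrix.charpoly_monic W).ne_zero,
        Polynomial.IsRoot, Matrix.eval_charpoly] at hc2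
      convert hc2 using 3
      ext i j; simp [Matrix.scalar_apply, Matrix.diagonal_apply, Matrix.one_apply]
    obtain ⟨R, hR1, hR2⟩ : ∃ R, (c • (1 : Matrix (Fin n) (Fin n) ℂ) - W) * R = 1 ∧
        R * (c • (1 : Matrix (Fin n) (Fin n) ℂ) - W) = 1 := by
      obtain ⟨u, hu⟩ := hc
      exact ⟨↑u⁻¹, by rw [← hu]; simp, by rw [← hu]; simp⟩
    set A := c • (1 : Matrix (Fin n) (Fin n) ℂ) - W with hA
    set B := c • (1 : Matrix (Fin n) (Fin n) ℂ) + W with hB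
    set H := I • (B * R) with hH
    have hcc : star c * c = 1 := by rw [Complex.star_def, Complex.conj_mul', hc1]; simp
    have hcomm : -(star B * A) = star A * B := by
      rw [hA, hB]
      simp only [star_add, star_sub, star_smul, star_one, add_mul, mul_sub, sub_mul, mul_add,
        smul_mul_assoc, mul_smul_comm, one_mul, mul_one, hW2, smul_add, smul_sub, smul_smul, hcc, mul_comm c (star c), one_smul]
      abel
    have hherm : H.IsHermitian := by
      have h1 : star R * star A = 1 := by rw [← star_mul, hR1, star_one]
      have : star R * star B = -(B * R) := by
        calc star R * star B = star R * (star B * A) * R := by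
              rw [mul_assoc, mul_assoc, hR1, mul_one]
          _ = - (star R * (star A * B) * R) := by rw [← hcomm]; simp
          _ = _ := by rw [← mul_assoc (star R), h1, one_mul]
      change star H = H
      rw [hH, star_smul, star_mul, this]
      simp
    have hHA : H * A = I • B := by
      rw [hH, smul_mul_assoc, mul_assoc, hR2, mul_one]
    have hHW : (H + I • 1) * W = c • (H - I • 1) := by
      have : c • H - H * W = (I * c) • 1 + I • W := by
        rw [hA, hB] at hHA
        simpa [mul_sub, smul_smul] using hHA
      have h2 : H * W = c • H - (I * c) • 1 - I • W := by rw [sub_sub, ← this]; abel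
      have hci : c • (I • (1 : Matrix (Fin n) (Fin n) ℂ)) = (I * c) • 1 := by
        rw [smul_smul, mul_comm]
      rw [add_mul, h2, smul_sub, hci, smul_mul_assoc, one_mul]; abel
    set Q := (hherm.eigenvectorUnitary : Matrix (Fin n) (Fin n) ℂ) with hQ
    have hQm : Q ∈ unitaryGroup (Fin n) ℂ := hherm.eigenvectorUnitary.2
    have hQ1 : Q * star Q = 1 := mem_unitaryGroup_iff.1 hQm
    have hQ2 : star Q * Q = 1 := mem_unitaryGroup_iff'.1 hQm
    set ev : Fin n → ℂ := fun i => (hherm.eigenvalues i : ℂ)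
    have hsp : star Q * H * Q = diagonal ev := by
      have := hherm.spectral_theorem
      rw [Unitary.conjStarAlgAut_apply] at this
      rw [this]
      change star Q * (Q * diagonal ev * star Q) * Q = _
      simp only [mul_assoc, hQ2, mul_one]
      rw [← mul_assoc, hQ2, one_mul]
    refine ⟨Q, hQm, fun i => c * (ev i - I) / (ev i + I), ?_⟩
    have hD : (diagonal ev + I • 1) * (star Q * W * Q) = c • (diagonal ev - I • 1) := by
      have e1 : diagonal ev + I • 1 = star Q * (H + I • 1) * Q := by
        rw [mul_add, add_mul, hsp]; simp [hQ2]
      have e2 : diagonal ev - I • 1 = star Q * (H - I • 1) * Q := by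
        rw [mul_sub, sub_mul, hsp]; simp [hQ2]
      rw [e1, e2]
      calc _ = star Q * (H + I • 1) * (Q * star Q) * W * Q := by simp only [mul_assoc]
        _ = star Q * ((H + I • 1) * W) * Q := by rw [hQ1]; simp only [mul_assoc, mul_one]
        _ = _ := by rw [hHW]; simp
    ext i j
    have := congrFun (congrFun hD i) j
    have e3 : diagonal ev + I • 1 = diagonal (fun i => ev i + I) := by
      ext i j; by_cases h : i = j <;> simp [h, Matrix.diagonal_apply, Matrix.one_apply]
    have e4 : c • (diagonal ev - I • 1) = diagonal (fun i => c * (ev i - I)) := by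
      ext i j; by_cases h : i = j <;> simp [h, Matrix.diagonal_apply, Matrix.one_apply]
    rw [e3, e4, Matrix.diagonal_mul] at this
    have hne : ev i + I ≠ 0 := by
      intro h0
      have := congrArg Complex.im h0
      simp [ev] at this
    by_cases h : i = j
    · subst h
      simp only [Matrix.diagonal_apply_eq] at this ⊢
      rw [eq_div_iff hne, mul_comm, this]
    · simp only [Matrix.diagonal_apply_ne _ h] at this ⊢
      exact (mul_eq_zero.1 this).resolve_left hne
  have hX1 : X * star X = 1 := mem_unitaryGroup_iff.1 hX
  have hX2 : star X * X = 1 := mem_unitaryGroup_iff'.1 hX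
  have hnorm : ∀ i, ‖l i‖ = 1 := by
    intro i
    have : star (diagonal l) * diagonal l = 1 := by
      rw [← hXl]
      simp only [star_mul, star_star]
      calc _ = star X * (star W * (X * star X) * W) * X := by simp only [mul_assoc]
        _ = _ := by rw [hX1, mul_one, hW2, mul_one, hX2]
    rw [star_eq_conjTranspose, diagonal_conjTranspose, diagonal_mul_diagonal] at this
    have := congrFun (congrFun this i) i
    simp [Complex.conj_mul'] at this
    rcases this with h | h
    · exact_mod_cast h
    · have h2 : ‖l i‖ = -1 := by exact_mod_cast h
      linarith [norm_nonneg (l i)]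
  obtain ⟨σ, hσ⟩ : ∃ σ : Equiv.Perm (Fin n), Antitone fun i => |(l (σ i)).arg| := by
    refine ⟨Tuple.sort (fun i => -|(l i).arg|), fun i j hij => ?_⟩
    have := Tuple.monotone_sort (fun i => -|(l i).arg|) hij
    simpa using this
  refine ⟨X.submatrix id σ, ?_, l ∘ σ, ?_, fun i => hnorm _, hσ⟩
  · rw [mem_unitaryGroup_iff', star_eq_conjTranspose, conjTranspose_submatrix,
      ← Matrix.submatrix_mul _ _ σ id σ Function.bijective_id, ← star_eq_conjTranspose, hX2,
      Matrix.submatrix_one_equiv]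
  · have h1 : diagonal (l ∘ σ) = (diagonal l).submatrix σ σ := by
      rw [Matrix.submatrix_diagonal_equiv]
    rw [h1, star_eq_conjTranspose, conjTranspose_submatrix,
      ← Matrix.submatrix_mul _ _ id σ σ σ.bijective, ← Matrix.submatrix_mul _ _ id σ id σ.bijective,
      ← hXl, ← star_eq_conjTranspose, Matrix.submatrix_id_id]
    symm
    calc X * (star X * W * X) * star X = (X * star X) * W * (X * star X) := by simp only [mul_assoc]
      _ = W := by rw [hX1, one_mul, mul_one]

lemma aux_angle (x y : ℂ) (hx : ‖x‖ = 1) (hy : ‖y‖ = 1) :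
    |x.arg| ≤ |y.arg| + InnerProductGeometry.angle x y := by
  have hx0 : x ≠ 0 := by rintro rfl; simp at hx
  have hy0 : y ≠ 0 := by rintro rfl; simp at hy
  rw [← Complex.angle_one_right hx0, ← Complex.angle_one_right hy0]
  have := InnerProductGeometry.angle_le_angle_add_angle x y 1
  linarith

lemma aux_chord (x y : ℂ) (hx : ‖x‖ = 1) (hy : ‖y‖ = 1) :
    InnerProductGeometry.angle x y ≤ ‖x - y‖ + ‖x - y‖ ^ 2 := by
  have hx0 : x ≠ 0 := by rintro rfl; simp at hx
  have hy0 : y ≠ 0 := by rintro rfl; simp at hy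
  have h1 := Complex.angle_le_mul_norm_sub hx hy
  have ha0 := InnerProductGeometry.angle_nonneg x y
  have hapi := InnerProductGeometry.angle_le_pi x y
  have hs : ‖x - y‖ = 2 * Real.sin (InnerProductGeometry.angle x y / 2) := by
    have e1 : ‖x - y‖ = ‖x / y - 1‖ := by
      rw [div_sub_one hy0, norm_div, hy, div_one]
    have e2 : x / y = Complex.exp (I * ((x / y).arg : ℝ)) := by
      have := Complex.norm_mul_exp_arg_mul_I (x / y)
      rw [norm_div, hx, hy] at this
      rw [mul_comm I]
      simpa using this.symm
    rw [Complex.angle_eq_abs_arg hx0 hy0] at *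
    rw [e1]
    conv_lhs => rw [e2]
    rw [Complex.norm_exp_I_mul_ofReal_sub_one]
    rw [norm_mul, Real.norm_eq_abs, Real.norm_eq_abs, abs_two]
    congr 1
    rcases abs_cases (x / y).arg with ⟨h, h'⟩ | ⟨h, h'⟩
    · rw [h] at hapi ⊢
      exact abs_of_nonneg (Real.sin_nonneg_of_nonneg_of_le_pi (by linarith) (by linarith))
    · rw [h] at hapi ⊢
      rw [neg_div, Real.sin_neg]
      apply abs_of_nonpos
      have := Real.sin_nonneg_of_nonneg_of_le_pi (x := -(x / y).arg / 2) (by linarith) (by linarith)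
      rw [neg_div, Real.sin_neg] at this
      linarith
  set a := InnerProductGeometry.angle x y
  set s := ‖x - y‖
  have hs0 : 0 ≤ s := norm_nonneg _
  have hpi := Real.pi_lt_d2
  have h2 : a ≤ 1.58 * s := by nlinarith
  rcases le_or_gt a 2 with h | h
  · rcases ha0.eq_or_lt with h0 | h0
    · rw [← h0]; positivity
    have := Real.sin_gt_sub_cube (x := a / 2) (by linarith)
    have h3 : a ^ 2 ≤ 2.5 * s ^ 2 := by nlinarith
    have h4 : a ^ 3 ≤ 2 * a ^ 2 := by nlinarith [sq_nonneg a]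
    nlinarith
  · nlinarith

lemma scalar_sum {ι : Type*} [Fintype ι] (l q : ι → ℂ) (p r : ι → ℝ) (l' : ℂ) (hl : ∀ i, ‖l i‖ = 1)
    (hq : ∀ i, ‖q i‖ = 1) (hl' : ‖l'‖ = 1) (hp1 : ∑ i, p i = 1) (hr1 : ∑ i, r i = 1)
    (h : ∑ i, (p i : ℂ) * (star (l i) * l') = ∑ i, (r i : ℂ) * q i) :
    ∑ i, p i * ‖l' - l i‖ ^ 2 = ∑ i, r i * ‖q i - 1‖ ^ 2 := by
  have key : ∀ z w : ℂ, ‖z‖ = 1 → ‖w‖ = 1 → ‖z - w‖ ^ 2 = 2 - 2 * (star w * z).re := by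
    intro z w hz hw
    have h1 : z.re * z.re + z.im * z.im = 1 := by
      rw [← Complex.normSq_apply, Complex.normSq_eq_norm_sq, hz]; norm_num
    have h2 : w.re * w.re + w.im * w.im = 1 := by
      rw [← Complex.normSq_apply, Complex.normSq_eq_norm_sq, hw]; norm_num
    rw [← Complex.normSq_eq_norm_sq, Complex.normSq_apply]
    simp
    linarith
  have h' := congrArg Complex.re h
  simp only [Complex.re_sum, Complex.re_ofReal_mul] at h'
  have e1 : ∑ i, p i * ‖l' - l i‖ ^ 2 = 2 * ∑ i, p i - 2 * ∑ i, p i * (star (l i) * l').re := by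
    rw [Finset.mul_sum, Finset.mul_sum, ← Finset.sum_sub_distrib]
    refine Finset.sum_congr rfl fun i _ => ?_
    rw [key _ _ hl' (hl i)]; ring
  have e2 : ∑ i, r i * ‖q i - 1‖ ^ 2 = 2 * ∑ i, r i - 2 * ∑ i, r i * (q i).re := by
    rw [Finset.mul_sum, Finset.mul_sum, ← Finset.sum_sub_distrib]
    refine Finset.sum_congr rfl fun i _ => ?_
    rw [key _ _ (hq i) (by simp)]; simp; ring
  rw [e1, e2, h', hp1, hr1]

lemma scalar_lip {ι : Type*} [Fintype ι] (l q : ι → ℂ) (p r : ι → ℝ) (l' : ℂ) (hl : ∀ i, ‖l i‖ = 1)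
    (hq : ∀ i, ‖q i‖ = 1) (hl' : ‖l'‖ = 1) (hp : ∀ i, 0 ≤ p i) (hr : ∀ i, 0 ≤ r i)
    (hp1 : ∑ i, p i = 1) (hr1 : ∑ i, r i = 1)
    (h : ∑ i, (p i : ℂ) * (star (l i) * l') = ∑ i, (r i : ℂ) * q i) (δ : ℝ) (hδ0 : 0 ≤ δ)
    (hδ : ∀ i, ‖q i - 1‖ ≤ δ) :
    |l'.arg| ≤ ∑ i, p i * |(l i).arg| + Real.pi / 2 * δ := by
  have h1 := scalar_sum l q p r l' hl hq hl' hp1 hr1 h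
  have h2 : ∑ i, r i * ‖q i - 1‖ ^ 2 ≤ δ ^ 2 := by
    calc _ ≤ ∑ i, r i * δ ^ 2 := Finset.sum_le_sum fun i _ =>
          mul_le_mul_of_nonneg_left (pow_le_pow_left₀ (norm_nonneg _) (hδ i) 2) (hr i)
      _ = _ := by rw [← Finset.sum_mul, hr1, one_mul]
  have h3 : (∑ i, p i * ‖l' - l i‖) ^ 2 ≤ ∑ i, p i * ‖l' - l i‖ ^ 2 :=
    Real.pow_arith_mean_le_arith_mean_pow _ _ _ (fun i _ => hp i) hp1
      (fun i _ => norm_nonneg _) 2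
  have h4 : ∑ i, p i * ‖l' - l i‖ ≤ δ := by
    apply le_of_sq_le_sq _ hδ0
    linarith
  have h5 : |l'.arg| = ∑ i, p i * |l'.arg| := by rw [← Finset.sum_mul, hp1, one_mul]
  rw [h5]
  calc _ ≤ ∑ i, (p i * |(l i).arg| + Real.pi / 2 * (p i * ‖l' - l i‖)) := by
        refine Finset.sum_le_sum fun i _ => ?_
        have := aux_angle l' (l i) hl' (hl i)
        have h6 := Complex.angle_le_mul_norm_sub hl' (hl i)
        have := mul_le_mul_of_nonneg_left (this.trans (add_le_add_right h6 _)) (hp i)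
        linarith
    _ ≤ _ := by
        rw [Finset.sum_add_distrib, ← Finset.mul_sum]
        have := Real.pi_pos
        gcongr

lemma scalar_sharp {ι : Type*} [Fintype ι] (l : ι → ℂ) (κ : ι → ℝ) (hl : ∀ i, ‖l i‖ = 1)
    (hκ : ∀ i, |κ i| ≤ Real.pi) : ∃ C : ℝ, ∃ ε₀ > 0, ∀ ε : ℝ, 0 < ε → ε < ε₀ →
      ∀ (p r : ι → ℝ) (l' : ℂ), ‖l'‖ = 1 → (∀ i, 0 ≤ p i) → (∀ i, 0 ≤ r i) →
      (∑ i, p i = 1) → (∑ i, r i = 1) →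
      (∑ i, (p i : ℂ) * (star (l i) * l') = ∑ i, (r i : ℂ) * exp ((ε * κ i : ℝ) * I)) →
      |l'.arg| ≤ ∑ i, p i * |(l i).arg| + ε * ∑ i, r i * |κ i| + C * ε ^ 2 := by
  classical
  have hpi := Real.pi_pos
  obtain ⟨δ, hδ, hgap⟩ : ∃ δ > 0, ∀ i j, l i ≠ l j → δ ≤ ‖l i - l j‖ := by
    have : ∀ᶠ δ in nhdsWithin (0:ℝ) (Set.Ioi 0), ∀ i j, l i ≠ l j → δ ≤ ‖l i - l j‖ := by
      rw [Filter.eventually_all]; intro i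
      rw [Filter.eventually_all]; intro j
      by_cases h : l i = l j
      · simp [h]
      · have : (0:ℝ) < ‖l i - l j‖ := norm_pos_iff.2 (sub_ne_zero.2 h)
        filter_upwards [mem_nhdsWithin_of_mem_nhds (Iic_mem_nhds this)] with δ hδ _ using hδ
    obtain ⟨δ, h1, h2⟩ := (this.and self_mem_nhdsWithin).exists
    exact ⟨δ, h2, h1⟩
  refine ⟨(Real.pi + 2) * (4 * Real.pi ^ 2 / δ ^ 2) + Real.pi ^ 2, δ / (2 * Real.pi), by positivity, ?_⟩
  intro ε hε hε0 p r l' hl' hp hr hp1 hr1 h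
  rw [lt_div_iff₀ (by positivity)] at hε0
  have hq : ∀ i, ‖exp ((ε * κ i : ℝ) * I) - 1‖ ≤ ε * |κ i| := by
    intro i
    have := Real.norm_exp_I_mul_ofReal_sub_one_le (x := ε * κ i)
    rw [mul_comm I] at this
    rwa [Real.norm_eq_abs, abs_mul, abs_of_pos hε] at this
  have h1 := scalar_sum l _ p r l' hl (fun i => Complex.norm_exp_ofReal_mul_I _) hl' hp1 hr1 h
  have h2 : ∑ i, p i * ‖l' - l i‖ ^ 2 ≤ (ε * Real.pi) ^ 2 := by
    rw [h1]
    calc _ ≤ ∑ i, r i * (ε * Real.pi) ^ 2 := Finset.sum_le_sum fun i _ =>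
          mul_le_mul_of_nonneg_left (pow_le_pow_left₀ (norm_nonneg _)
            ((hq i).trans (mul_le_mul_of_nonneg_left (hκ i) hε.le)) 2) (hr i)
      _ = _ := by rw [← Finset.sum_mul, hr1, one_mul]
  obtain ⟨i₀, hi₀⟩ : ∃ i, ‖l' - l i‖ ≤ ε * Real.pi := by
    by_contra! hc
    have : ∑ i, p i * (ε * Real.pi) ^ 2 < ∑ i, p i * ‖l' - l i‖ ^ 2 := by
      apply Finset.sum_lt_sum
      · intro i _
        exact mul_le_mul_of_nonneg_left (pow_le_pow_left₀ (by positivity) (hc i).le 2) (hp i)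
      · by_contra! hc2
        have : ∀ i, p i = 0 := by
          intro i
          by_contra h0
          have h3 : 0 < p i := lt_of_le_of_ne (hp i) (Ne.symm h0)
          have := hc2 i (Finset.mem_univ _)
          exact absurd this (not_le.2 (mul_lt_mul_of_pos_left
            (pow_lt_pow_left₀ (hc i) (by positivity) two_ne_zero) h3))
        simp [this] at hp1
    rw [← Finset.sum_mul, hp1, one_mul] at this
    linarith
  set w : ι → ℝ := fun i => if l i = l i₀ then 0 else p i with hw
  have hw0 : ∀ i, 0 ≤ w i := fun i => by simp only [hw]; split_ifs; exacts [le_rfl, hp i]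
  have hm : (∑ i, w i) * (δ ^ 2 / 4) ≤ (ε * Real.pi) ^ 2 := by
    refine le_trans ?_ h2
    rw [Finset.sum_mul]
    refine Finset.sum_le_sum fun i _ => ?_
    simp only [hw]
    split_ifs with hi
    · rw [zero_mul]; exact mul_nonneg (hp i) (sq_nonneg _)
    · apply mul_le_mul_of_nonneg_left _ (hp i)
      have h3 := hgap i i₀ hi
      have h4 : ‖l i - l i₀‖ ≤ ‖l' - l i‖ + ‖l' - l i₀‖ := by
        have := norm_sub_le (l' - l i₀) (l' - l i)
        rw [show l' - l i₀ - (l' - l i) = l i - l i₀ by ring] at this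
        linarith
      have : δ / 2 ≤ ‖l' - l i‖ := by nlinarith
      have := pow_le_pow_left₀ (by positivity) this 2
      linarith
  have hm' : ∑ i, w i ≤ 4 * Real.pi ^ 2 / δ ^ 2 * ε ^ 2 := by
    rw [← le_div_iff₀ (by positivity)] at hm
    refine hm.trans (le_of_eq ?_)
    field_simp
  have h3 : |(l i₀).arg| ≤ ∑ i, p i * |(l i).arg| + Real.pi * ∑ i, w i := by
    have h5 : |(l i₀).arg| = ∑ i, p i * |(l i₀).arg| := by rw [← Finset.sum_mul, hp1, one_mul]
    rw [h5, Finset.mul_sum, ← Finset.sum_add_distrib]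
    refine Finset.sum_le_sum fun i _ => ?_
    simp only [hw]
    split_ifs with hi
    · rw [hi]; simp
    · have := mul_le_mul_of_nonneg_left (Complex.abs_arg_le_pi (l i₀)) (hp i)
      have := mul_nonneg (hp i) (abs_nonneg (l i).arg)
      linarith
  have h4 : ‖l' - l i₀‖ ≤ ε * ∑ i, r i * |κ i| + 2 * ∑ i, w i := by
    have e0 : ‖l' - l i₀‖ = ‖star (l i₀) * l' - 1‖ := by
      have : star (l i₀) * l i₀ = 1 := by
        rw [Complex.star_def, Complex.conj_mul', hl]; simp
      rw [← this, ← mul_sub, norm_mul, norm_star, hl, one_mul]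
    have e1 : star (l i₀) * l' - 1 = ∑ i, (r i : ℂ) * (exp ((ε * κ i : ℝ) * I) - 1)
        - ∑ i, (p i : ℂ) * ((star (l i) - star (l i₀)) * l') := by
      have hp1' : ∑ i, (p i : ℂ) = 1 := by exact_mod_cast hp1
      have hr1' : ∑ i, (r i : ℂ) = 1 := by exact_mod_cast hr1
      simp only [mul_sub, sub_mul, Finset.sum_sub_distrib, h, mul_one, hr1']
      rw [← Finset.sum_mul, hp1']; ring
    rw [e0, e1]
    refine (norm_sub_le _ _).trans (add_le_add ?_ ?_)
    · refine (norm_sum_le _ _).trans ?_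
      rw [Finset.mul_sum]
      refine Finset.sum_le_sum fun i _ => ?_
      rw [norm_mul, Complex.norm_real, Real.norm_eq_abs, abs_of_nonneg (hr i)]
      have := mul_le_mul_of_nonneg_left (hq i) (hr i)
      linarith
    · refine (norm_sum_le _ _).trans ?_
      rw [Finset.mul_sum]
      refine Finset.sum_le_sum fun i _ => ?_
      simp only [hw]
      split_ifs with hi
      · simp [hi]
      · rw [norm_mul, Complex.norm_real, Real.norm_eq_abs, abs_of_nonneg (hp i), norm_mul, hl',
          mul_one, ← star_sub, norm_star]
        have := norm_sub_le (l i) (l i₀)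
        rw [hl, hl] at this
        nlinarith [hp i]
  have h5 := aux_angle l' (l i₀) hl' (hl i₀)
  have h6 := aux_chord l' (l i₀) hl' (hl i₀)
  have h7 : ‖l' - l i₀‖ ^ 2 ≤ (ε * Real.pi) ^ 2 := pow_le_pow_left₀ (norm_nonneg _) hi₀ 2
  have h8 := mul_le_mul_of_nonneg_left hm' (by positivity : 0 ≤ Real.pi + 2)
  nlinarith


lemma unit_col {n : ℕ} (Z : Matrix (Fin n) (Fin n) ℂ) (hZ : Z ∈ unitaryGroup (Fin n) ℂ) (j : Fin n) :
    ∑ i, ‖Z i j‖ ^ 2 = 1 := by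
  have := congrFun (congrFun (mem_unitaryGroup_iff'.1 hZ) j) j
  rw [Matrix.mul_apply] at this
  simp [star_apply, Complex.conj_mul'] at this
  exact_mod_cast this

lemma conj_diag_apply {n : ℕ} (Y X : Matrix (Fin n) (Fin n) ℂ) (l : Fin n → ℂ) (j : Fin n) :
    (star X * (Y * diagonal l * star Y) * X) j j
      = ∑ i, ((‖(star Y * X) i j‖ ^ 2 : ℝ) : ℂ) * l i := by
  have : star X * (Y * diagonal l * star Y) * X = star (star Y * X) * diagonal l * (star Y * X) := by
    simp only [star_mul, star_star, mul_assoc]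
  rw [this, Matrix.mul_apply]
  refine Finset.sum_congr rfl fun i _ => ?_
  rw [Matrix.mul_diagonal, star_apply]
  push_cast
  rw [← Complex.conj_mul', Complex.star_def]
  ring

lemma eig_identity {n : ℕ} (Y X Q : Matrix (Fin n) (Fin n) ℂ)
    (hY : Y ∈ unitaryGroup (Fin n) ℂ) (hX : X ∈ unitaryGroup (Fin n) ℂ)
    (l l' v : Fin n → ℂ) (hl : ∀ i, ‖l i‖ = 1)
    (h : (Y * diagonal l * star Y) * (Q * diagonal v * star Q) = X * diagonal l' * star X)
    (j : Fin n) :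
    ∑ i, ((‖(star Y * X) i j‖ ^ 2 : ℝ) : ℂ) * (star (l i) * l' j)
      = ∑ i, ((‖(star Q * X) i j‖ ^ 2 : ℝ) : ℂ) * v i := by
  have hY2 : star Y * Y = 1 := mem_unitaryGroup_iff'.1 hY
  have hY1 : Y * star Y = 1 := mem_unitaryGroup_iff.1 hY
  have hX2 : star X * X = 1 := mem_unitaryGroup_iff'.1 hX
  have hD : diagonal (fun i => star (l i)) * diagonal l = 1 := by
    rw [diagonal_mul_diagonal, ← diagonal_one]
    congr 1; ext i
    rw [Complex.star_def, Complex.conj_mul', hl]; simp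
  have e1 : Q * diagonal v * star Q
      = (Y * diagonal (fun i => star (l i)) * star Y) * (X * diagonal l' * star X) := by
    rw [← h]
    calc _ = (Y * star Y) * (Q * diagonal v * star Q) := by rw [hY1, one_mul]
      _ = (Y * (diagonal (fun i => star (l i)) * diagonal l) * star Y) * (Q * diagonal v * star Q) := by
          rw [hD, mul_one]
      _ = (Y * diagonal (fun i => star (l i)) * (star Y * Y) * diagonal l * star Y)
            * (Q * diagonal v * star Q) := by rw [hY2, mul_one]; simp only [mul_assoc]
      _ = _ := by simp only [mul_assoc]
  rw [← conj_diag_apply Q X v j, e1]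
  have e2 : star X * (Y * diagonal (fun i => star (l i)) * star Y * (X * diagonal l' * star X)) * X
      = (star X * (Y * diagonal (fun i => star (l i)) * star Y) * X) * diagonal l' := by
    calc _ = star X * (Y * diagonal (fun i => star (l i)) * star Y) * X * diagonal l' *
        (star X * X) := by simp only [mul_assoc]
      _ = _ := by rw [hX2, mul_one]
  rw [e2, Matrix.mul_diagonal, conj_diag_apply, Finset.sum_mul]
  simp only [mul_assoc]

lemma conj_diag_mem {n : ℕ} (Q : Matrix (Fin n) (Fin n) ℂ) (hQ : Q ∈ unitaryGroup (Fin n) ℂ)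
    (v : Fin n → ℂ) (hv : ∀ i, ‖v i‖ = 1) :
    Q * diagonal v * star Q ∈ unitaryGroup (Fin n) ℂ := by
  have hd : diagonal v ∈ unitaryGroup (Fin n) ℂ := by
    rw [mem_unitaryGroup_iff', star_eq_conjTranspose, diagonal_conjTranspose,
      diagonal_mul_diagonal, ← diagonal_one]
    congr 1; ext i
    rw [Pi.star_apply, Complex.star_def, Complex.conj_mul', hv]; simp
  exact mul_mem (mul_mem hQ hd) (Unitary.star_mem hQ)

lemma nu_lip {n : ℕ} (μ : Fin n → ℝ) (hμ : Antitone μ) (hμ0 : ∀ j, 0 ≤ μ j)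
    (W Q : Matrix (Fin n) (Fin n) ℂ) (hW : W ∈ unitaryGroup (Fin n) ℂ)
    (hQ : Q ∈ unitaryGroup (Fin n) ℂ) (v : Fin n → ℂ) (hv : ∀ i, ‖v i‖ = 1) (δ : ℝ) (hδ0 : 0 ≤ δ)
    (hδ : ∀ i, ‖v i - 1‖ ≤ δ) :
    nu μ (W * (Q * diagonal v * star Q)) ≤ nu μ W + (∑ j, μ j) * (Real.pi / 2) * δ := by
  have hW' := mul_mem hW (conj_diag_mem Q hQ v hv)
  obtain ⟨Y, hY, l, hWl, hl, hla⟩ := diag_exists W hW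
  obtain ⟨X, hX, l', hWl', hl', hla'⟩ := diag_exists _ hW'
  rw [hWl', nu_eq μ X hX l' hla', hWl, nu_eq μ Y hY l hla]
  rw [hWl] at hWl'
  have hZ : star Y * X ∈ unitaryGroup (Fin n) ℂ := mul_mem (Unitary.star_mem hY) hX
  have hR : star Q * X ∈ unitaryGroup (Fin n) ℂ := mul_mem (Unitary.star_mem hQ) hX
  have key : ∀ j, |(l' j).arg| ≤ ∑ i, ‖(star Y * X) i j‖ ^ 2 * |(l i).arg| + Real.pi / 2 * δ :=
    fun j => scalar_lip l v _ (fun i => ‖(star Q * X) i j‖ ^ 2) (l' j) hl hv (hl' j)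
      (fun i => sq_nonneg _) (fun i => sq_nonneg _) (unit_col _ hZ j) (unit_col _ hR j)
      (eig_identity Y X Q hY hX l l' v hl hWl' j) δ hδ0 hδ
  calc _ ≤ ∑ j, (μ j * ∑ i, ‖(star Y * X) i j‖ ^ 2 * |(l i).arg| + μ j * (Real.pi / 2 * δ)) := by
        refine Finset.sum_le_sum fun j _ => ?_
        rw [← mul_add]
        exact mul_le_mul_of_nonneg_left (key j) (hμ0 j)
    _ ≤ _ := by
        rw [Finset.sum_add_distrib, ← Finset.sum_mul]
        have := ds_le μ _ hμ hla _ hZ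
        linarith

lemma nu_sharp {n : ℕ} (μ : Fin n → ℝ) (hμ : Antitone μ) (hμ0 : ∀ j, 0 ≤ μ j)
    (W Q : Matrix (Fin n) (Fin n) ℂ) (hW : W ∈ unitaryGroup (Fin n) ℂ)
    (hQ : Q ∈ unitaryGroup (Fin n) ℂ) (κ : Fin n → ℝ) (hκ : ∀ i, |κ i| ≤ Real.pi)
    (hκa : Antitone fun i => |κ i|) :
    ∃ C : ℝ, ∃ ε₀ > 0, ∀ ε : ℝ, 0 < ε → ε < ε₀ →
    nu μ (W * (Q * diagonal (fun i => exp ((ε * κ i : ℝ) * I)) * star Q)) ≤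
      nu μ W + ε * (∑ j, μ j * |κ j|) + C * ε ^ 2 := by
  obtain ⟨Y, hY, l, hWl, hl, hla⟩ := diag_exists W hW
  obtain ⟨C, ε₀, hε₀, hC⟩ := scalar_sharp l κ hl hκ
  refine ⟨(∑ j, μ j) * C, ε₀, hε₀, fun ε h0 h1 => ?_⟩
  set v : Fin n → ℂ := fun i => exp ((ε * κ i : ℝ) * I) with hvdef
  have hv : ∀ i, ‖v i‖ = 1 := fun i => Complex.norm_exp_ofReal_mul_I _
  have hW' := mul_mem hW (conj_diag_mem Q hQ v hv)
  obtain ⟨X, hX, l', hWl', hl', hla'⟩ := diag_exists _ hW'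
  rw [hWl', nu_eq μ X hX l' hla', hWl, nu_eq μ Y hY l hla]
  rw [hWl] at hWl'
  have hZ : star Y * X ∈ unitaryGroup (Fin n) ℂ := mul_mem (Unitary.star_mem hY) hX
  have hR : star Q * X ∈ unitaryGroup (Fin n) ℂ := mul_mem (Unitary.star_mem hQ) hX
  have key := fun j => hC ε h0 h1 _ (fun i => ‖(star Q * X) i j‖ ^ 2) (l' j) (hl' j)
      (fun i => sq_nonneg _) (fun i => sq_nonneg _) (unit_col _ hZ j) (unit_col _ hR j)
      (eig_identity Y X Q hY hX l l' v hl hWl' j)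
  calc _ ≤ ∑ j, (μ j * ∑ i, ‖(star Y * X) i j‖ ^ 2 * |(l i).arg|
          + ε * (μ j * ∑ i, ‖(star Q * X) i j‖ ^ 2 * |κ i|) + μ j * (C * ε ^ 2)) := by
        refine Finset.sum_le_sum fun j _ => ?_
        have := mul_le_mul_of_nonneg_left (key j) (hμ0 j)
        linarith
    _ ≤ _ := by
        rw [Finset.sum_add_distrib, Finset.sum_add_distrib, ← Finset.sum_mul, ← Finset.mul_sum]
        have h2 := ds_le μ _ hμ hla _ hZ
        have h3 := mul_le_mul_of_nonneg_left (ds_le μ _ hμ hκa _ hR) h0.le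
        linarith

lemma nu_mul_le {n : ℕ} (μ : Fin n → ℝ) (hμ : Antitone μ) (hμ0 : ∀ j, 0 ≤ μ j)
    (W V : Matrix (Fin n) (Fin n) ℂ) (hW : W ∈ unitaryGroup (Fin n) ℂ)
    (hV : V ∈ unitaryGroup (Fin n) ℂ) :
    nu μ (W * V) ≤ nu μ W + nu μ V := by
  obtain ⟨Q, hQ, v, hVv, hv, hva⟩ := diag_exists V hV
  have hQ1 : Q * star Q = 1 := mem_unitaryGroup_iff.1 hQ
  have hQ2 : star Q * Q = 1 := mem_unitaryGroup_iff'.1 hQ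
  set κ : Fin n → ℝ := fun i => (v i).arg with hκdef
  have hκ : ∀ i, |κ i| ≤ Real.pi := fun i => Complex.abs_arg_le_pi _
  set E : ℝ → Matrix (Fin n) (Fin n) ℂ :=
    fun t => Q * diagonal (fun i => exp ((t * κ i : ℝ) * I)) * star Q with hE
  have hEm : ∀ t, E t ∈ unitaryGroup (Fin n) ℂ := fun t =>
    conj_diag_mem Q hQ _ fun i => Complex.norm_exp_ofReal_mul_I _
  have hE0 : E 0 = 1 := by simp [hE, hQ1]
  have hE1 : E 1 = V := by
    rw [hVv, hE]
    have : (fun i => exp (((1:ℝ) * κ i : ℝ) * I)) = v := by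
      ext i
      have := Complex.norm_mul_exp_arg_mul_I (v i)
      rw [hv i] at this
      simpa [hκdef] using this
    simp only [this]
  have hEadd : ∀ s t, E (s + t) = E s * E t := by
    intro s t
    simp only [hE]
    have : diagonal (fun i => exp (((s + t) * κ i : ℝ) * I))
        = diagonal (fun i => exp ((s * κ i : ℝ) * I)) * diagonal (fun i => exp ((t * κ i : ℝ) * I)) := by
      rw [diagonal_mul_diagonal]
      congr 1; ext i
      rw [← Complex.exp_add]; congr 1; push_cast; ring
    rw [this]
    calc _ = Q * diagonal (fun i => exp ((s * κ i : ℝ) * I)) * 1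
          * diagonal (fun i => exp ((t * κ i : ℝ) * I)) * star Q := by
            simp only [mul_assoc, one_mul]
      _ = _ := by rw [← hQ2]; simp only [mul_assoc]
  set f : ℝ → ℝ := fun t => nu μ (W * E t) with hf
  have hL : nu μ V = ∑ j, μ j * |κ j| := by rw [hVv, nu_eq μ Q hQ v hva]
  set K := (∑ j, μ j) * (Real.pi / 2) * Real.pi with hK
  have hpi := Real.pi_pos
  have hK0 : 0 ≤ K := by
    have := Finset.sum_nonneg fun j (_ : j ∈ Finset.univ) => hμ0 j
    positivity
  have hlip : ∀ s t, f s ≤ f t + K * |s - t| := by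
    intro s t
    have h1 : W * E s = (W * E t) * E (s - t) := by rw [mul_assoc, ← hEadd]; congr 2; ring
    have := nu_lip μ hμ hμ0 (W * E t) Q (mul_mem hW (hEm t)) hQ
      (fun i => exp (((s - t) * κ i : ℝ) * I)) (fun i => Complex.norm_exp_ofReal_mul_I _)
      (Real.pi * |s - t|) (by positivity) (by
        intro i
        have := Real.norm_exp_I_mul_ofReal_sub_one_le (x := (s - t) * κ i)
        rw [mul_comm I] at this
        refine this.trans ?_
        rw [Real.norm_eq_abs, abs_mul, mul_comm]
        exact mul_le_mul_of_nonneg_right (hκ i) (abs_nonneg _))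
    simp only [hf]
    rw [h1]
    refine this.trans (le_of_eq ?_)
    rw [hK]; ring
  have hcont : Continuous f := by
    apply LipschitzWith.continuous (K := K.toNNReal)
    apply LipschitzWith.of_dist_le_mul
    intro s t
    rw [Real.coe_toNNReal _ hK0, Real.dist_eq, Real.dist_eq, abs_sub_le_iff]
    have h1 := hlip s t
    have h2 := hlip t s
    rw [abs_sub_comm t s] at h2
    constructor <;> linarith
  have hfin : ∀ η > 0, f 1 ≤ f 0 + (nu μ V + η) := by
    intro η hη
    have := image_le_of_liminf_slope_right_lt_deriv_boundary (f := f) (f' := fun _ => nu μ V)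
      (a := 0) (b := 1) hcont.continuousOn ?_ (B := fun x => f 0 + (nu μ V + η) * x)
      (B' := fun _ => nu μ V + η) (by simp) ?_ (fun x _ _ => by linarith)
      (x := 1) (by simp)
    · simpa using this
    · intro t _ r hr
      apply Filter.Eventually.frequently
      obtain ⟨C, ε₀, hε₀, hC⟩ := nu_sharp μ hμ hμ0 (W * E t) Q (mul_mem hW (hEm t)) hQ κ hκ hva
      have ev1 : ∀ᶠ z in nhdsWithin t (Set.Ioi t), z < t + ε₀ :=
        mem_nhdsWithin_of_mem_nhds (Iio_mem_nhds (by linarith))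
      have ev2 : ∀ᶠ z in nhdsWithin t (Set.Ioi t), C * (z - t) < r - nu μ V := by
        apply mem_nhdsWithin_of_mem_nhds
        have : ContinuousAt (fun z => C * (z - t)) t := by fun_prop
        apply this.eventually_lt continuousAt_const
        simpa using hr
      filter_upwards [ev1, ev2, self_mem_nhdsWithin] with z h1 h2 h3
      have h3 : t < z := h3
      have h4 := hC (z - t) (by linarith) (by linarith)
      rw [← hL] at h4
      have h5 : W * E z = (W * E t) * E (z - t) := by rw [mul_assoc, ← hEadd]; congr 2; ring
      have h6 : f z ≤ f t + (z - t) * nu μ V + C * (z - t) ^ 2 := by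
        simp only [hf]; rw [h5]; exact h4
      rw [slope_def_field, div_lt_iff₀ (by linarith)]
      nlinarith
    · intro x
      have := ((hasDerivAt_id x).const_mul (nu μ V + η)).const_add (f 0)
      simpa using this
  have h1 : f 1 = nu μ (W * V) := by simp only [hf, hE1]
  have h0 : f 0 = nu μ W := by simp only [hf, hE0, mul_one]
  rw [← h1, ← h0]
  apply le_of_forall_pos_le_add
  intro η hη
  linarith [hfin η hη]


lemma smul_exp_mem {n : ℕ} (M : Matrix (Fin n) (Fin n) ℂ) (hM : M ∈ unitaryGroup (Fin n) ℂ) (x : ℝ) :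
    Complex.exp (x * I) • M ∈ unitaryGroup (Fin n) ℂ := by
  have hM1 : M * star M = 1 := mem_unitaryGroup_iff.1 hM
  rw [mem_unitaryGroup_iff, star_smul, smul_mul_smul_comm, hM1, Complex.star_def, Complex.mul_conj',
    Complex.norm_exp_ofReal_mul_I]
  simp

lemma nu_nonneg {n : ℕ} (μ : Fin n → ℝ) (hμ0 : ∀ j, 0 ≤ μ j)
    (W : Matrix (Fin n) (Fin n) ℂ) (hW : W ∈ unitaryGroup (Fin n) ℂ) : 0 ≤ nu μ W := by
  obtain ⟨X, hX, l, hWl, hl, hla⟩ := diag_exists W hW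
  rw [hWl, nu_eq μ X hX l hla]
  exact Finset.sum_nonneg fun j _ => mul_nonneg (hμ0 j) (abs_nonneg _)

lemma nu_star_eq {n : ℕ} (μ : Fin n → ℝ)
    (W : Matrix (Fin n) (Fin n) ℂ) (hW : W ∈ unitaryGroup (Fin n) ℂ) : nu μ (star W) = nu μ W := by
  obtain ⟨X, hX, l, hWl, hl, hla⟩ := diag_exists W hW
  have habs : ∀ i, |(star (l i)).arg| = |(l i).arg| := by
    intro i
    rw [Complex.star_def, Complex.arg_conj]
    split_ifs with h
    · rw [h]
    · rw [abs_neg]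
  have h1 : star W = X * diagonal (fun i => star (l i)) * star X := by
    rw [hWl, star_mul, star_mul, star_star, star_eq_conjTranspose (diagonal l),
      diagonal_conjTranspose, mul_assoc]
    rfl
  rw [h1, nu_eq μ X hX _ (by simpa only [habs] using hla), hWl, nu_eq μ X hX l hla]
  simp only [habs]

lemma nu_eq_zero {n : ℕ} (μ : Fin n → ℝ) (hμ : Antitone μ) (hμ0 : ∀ j, 0 ≤ μ j) (hμne : μ ≠ 0)
    (W : Matrix (Fin n) (Fin n) ℂ) (hW : W ∈ unitaryGroup (Fin n) ℂ) (h : nu μ W = 0) : W = 1 := by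
  obtain ⟨X, hX, l, hWl, hl, hla⟩ := diag_exists W hW
  obtain ⟨j, hj⟩ := Function.ne_iff.1 hμne
  have hj : 0 < μ j := lt_of_le_of_ne (hμ0 j) (Ne.symm hj)
  have hn : 0 < n := j.pos
  rw [hWl, nu_eq μ X hX l hla, Finset.sum_eq_zero_iff_of_nonneg
    (fun j _ => mul_nonneg (hμ0 j) (abs_nonneg _))] at h
  have h0 := h ⟨0, hn⟩ (Finset.mem_univ _)
  have hmu : 0 < μ ⟨0, hn⟩ := hj.trans_le (hμ (Fin.mk_le_of_le_val (Nat.zero_le _)))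
  have h1 : |(l ⟨0, hn⟩).arg| = 0 := (mul_eq_zero.1 h0).resolve_left hmu.ne'
  have hl1 : l = fun _ => 1 := by
    ext i
    have h2 : |(l i).arg| ≤ |(l ⟨0, hn⟩).arg| := hla (Fin.mk_le_of_le_val (Nat.zero_le _))
    have h3 : (l i).arg = 0 := abs_eq_zero.1 (le_antisymm (h2.trans h1.le) (abs_nonneg _))
    have := Complex.norm_mul_exp_arg_mul_I (l i)
    rw [hl i, h3] at this
    simpa using this.symm
  rw [hWl, hl1, diagonal_one, mul_one, mem_unitaryGroup_iff.1 hX]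

lemma nuStar_bdd {n : ℕ} (μ : Fin n → ℝ) (hμ0 : ∀ j, 0 ≤ μ j)
    (M : Matrix (Fin n) (Fin n) ℂ) (hM : M ∈ unitaryGroup (Fin n) ℂ) :
    BddBelow (Set.range fun x : ℝ => nu μ (Complex.exp (x * Complex.I) • M)) :=
  ⟨0, by rintro _ ⟨x, rfl⟩; exact nu_nonneg μ hμ0 _ (smul_exp_mem M hM x)⟩

lemma nuStar_nonneg {n : ℕ} (μ : Fin n → ℝ) (hμ0 : ∀ j, 0 ≤ μ j)
    (M : Matrix (Fin n) (Fin n) ℂ) (hM : M ∈ unitaryGroup (Fin n) ℂ) : 0 ≤ nuStar μ M :=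
  le_ciInf fun x => nu_nonneg μ hμ0 _ (smul_exp_mem M hM x)

lemma nuStar_star {n : ℕ} (μ : Fin n → ℝ)
    (M : Matrix (Fin n) (Fin n) ℂ) (hM : M ∈ unitaryGroup (Fin n) ℂ) :
    nuStar μ (star M) = nuStar μ M := by
  unfold nuStar
  rw [← (Equiv.neg ℝ).iInf_comp]
  congr 1; ext x
  rw [← nu_star_eq μ _ (smul_exp_mem M hM x), star_smul, Complex.star_def, ← Complex.exp_conj]
  simp

lemma nuStar_mul {n : ℕ} (μ : Fin n → ℝ) (hμ : Antitone μ) (hμ0 : ∀ j, 0 ≤ μ j)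
    (M N : Matrix (Fin n) (Fin n) ℂ) (hM : M ∈ unitaryGroup (Fin n) ℂ)
    (hN : N ∈ unitaryGroup (Fin n) ℂ) :
    nuStar μ (M * N) ≤ nuStar μ M + nuStar μ N := by
  refine le_ciInf_add_ciInf fun x y => ?_
  refine (ciInf_le (nuStar_bdd μ hμ0 _ (mul_mem hM hN)) (x + y)).trans ?_
  have : Complex.exp ((x + y : ℝ) * I) • (M * N)
      = (Complex.exp (x * I) • M) * (Complex.exp (y * I) • N) := by
    rw [smul_mul_smul_comm, ← Complex.exp_add]; congr 2; push_cast; ring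
  rw [this]
  exact nu_mul_le μ hμ hμ0 _ _ (smul_exp_mem M hM x) (smul_exp_mem N hN y)

lemma nuStar_attained {n : ℕ} (μ : Fin n → ℝ) (hμ : Antitone μ) (hμ0 : ∀ j, 0 ≤ μ j)
    (M : Matrix (Fin n) (Fin n) ℂ) (hM : M ∈ unitaryGroup (Fin n) ℂ) :
    ∃ x : ℝ, nu μ (Complex.exp (x * Complex.I) • M) = nuStar μ M := by
  set f : ℝ → ℝ := fun x => nu μ (Complex.exp (x * Complex.I) • M) with hf
  set K := (∑ j, μ j) * (Real.pi / 2) with hK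
  have hpi := Real.pi_pos
  have hK0 : 0 ≤ K := by
    have := Finset.sum_nonneg fun j (_ : j ∈ Finset.univ) => hμ0 j
    positivity
  have hlip : ∀ s t, f s ≤ f t + K * |s - t| := by
    intro s t
    have h1 : Complex.exp (s * I) • M = (Complex.exp (t * I) • M) *
        (1 * diagonal (fun _ => exp (((s - t : ℝ) : ℂ) * I)) * star 1) := by
      rw [star_one, mul_one, one_mul, ← Matrix.smul_one_eq_diagonal, mul_smul_comm, mul_one,
        smul_smul, ← Complex.exp_add]
      congr 2; push_cast; ring
    simp only [hf]
    rw [h1]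
    refine nu_lip μ hμ hμ0 _ 1 (smul_exp_mem M hM t) (one_mem _)
      (fun i => exp (((s - t : ℝ) : ℂ) * I)) (fun i => Complex.norm_exp_ofReal_mul_I _)
      |s - t| (abs_nonneg _) ?_
    intro i
    have := Real.norm_exp_I_mul_ofReal_sub_one_le (x := s - t)
    rwa [mul_comm I] at this
  have hcont : Continuous f := by
    apply LipschitzWith.continuous (K := K.toNNReal)
    apply LipschitzWith.of_dist_le_mul
    intro s t
    rw [Real.coe_toNNReal _ hK0, Real.dist_eq, Real.dist_eq, abs_sub_le_iff]
    have h1 := hlip s t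
    have h2 := hlip t s
    rw [abs_sub_comm t s] at h2
    constructor <;> linarith
  have hper : Function.Periodic f (2 * Real.pi) := by
    intro x
    simp only [hf]
    congr 2
    push_cast
    rw [add_mul, Complex.exp_periodic]
  have hc := hper.compact_of_continuous (by positivity) hcont
  exact hc.sInf_mem (Set.range_nonempty f)

theorem stmt14 {n : ℕ} (μ : Fin n → ℝ) (hμ : Antitone μ) (hμ0 : ∀ j, 0 ≤ μ j)
    (hμne : μ ≠ 0)
    (d : Matrix.unitaryGroup (Fin n) ℂ → Matrix.unitaryGroup (Fin n) ℂ → ℝ)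
    (hd : ∀ U V : Matrix.unitaryGroup (Fin n) ℂ,
      d U V = nuStar μ ((U * V⁻¹ : Matrix.unitaryGroup (Fin n) ℂ) : Matrix (Fin n) (Fin n) ℂ)) :
    (∀ U V, 0 ≤ d U V) ∧ (∀ U V, d U V = d V U) ∧ (∀ U, d U U = 0) ∧
      (∀ U V W, d U W ≤ d U V + d V W) ∧
      (∀ U V, d U V = 0 ↔ ∃ x : ℝ,
        (V : Matrix (Fin n) (Fin n) ℂ) = Complex.exp (x * Complex.I) • (U : Matrix (Fin n) (Fin n) ℂ)) := by
  have hm : ∀ U : Matrix.unitaryGroup (Fin n) ℂ,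
      (U : Matrix (Fin n) (Fin n) ℂ) ∈ Matrix.unitaryGroup (Fin n) ℂ := fun U => U.2
  have hself : ∀ U, 0 ≤ d U U := fun U => by rw [hd]; exact nuStar_nonneg μ hμ0 _ (hm _)
  have hzero : ∀ (M : Matrix (Fin n) (Fin n) ℂ), M = 1 → nu μ M = 0 := by
    rintro M rfl
    have := nu_eq μ 1 (one_mem _) (fun _ => 1) (fun i j _ => le_rfl)
    simpa using this
  have hphase : ∀ (x : ℝ) (M : Matrix (Fin n) (Fin n) ℂ), M ∈ Matrix.unitaryGroup (Fin n) ℂ →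
      Complex.exp (x * Complex.I) • M = 1 → nuStar μ M = 0 := by
    intro x M hM hx
    apply le_antisymm _ (nuStar_nonneg μ hμ0 _ hM)
    have := ciInf_le (nuStar_bdd μ hμ0 M hM) x
    exact this.trans (hzero _ hx).le
  refine ⟨?_, ?_, ?_, ?_, ?_⟩
  · intro U V
    rw [hd]; exact nuStar_nonneg μ hμ0 _ (hm _)
  · intro U V
    rw [hd, hd, ← nuStar_star μ _ (hm (U * V⁻¹))]
    congr 1
    change ((star (U * V⁻¹) : Matrix.unitaryGroup (Fin n) ℂ) : Matrix (Fin n) (Fin n) ℂ) = _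
    congr 1
    change (U * V⁻¹)⁻¹ = _
    group
  · intro U
    rw [hd]
    exact hphase 0 _ (hm _) (by simp)
  · intro U V W
    rw [hd, hd, hd]
    have := nuStar_mul μ hμ hμ0 _ _ (hm (U * V⁻¹)) (hm (V * W⁻¹))
    rwa [← Submonoid.coe_mul, show U * V⁻¹ * (V * W⁻¹) = U * W⁻¹ by group] at this
  · intro U V
    have hV1 : (V : Matrix (Fin n) (Fin n) ℂ) * star (V : Matrix (Fin n) (Fin n) ℂ) = 1 :=
      Matrix.mem_unitaryGroup_iff.1 (hm V)
    have hV2 : star (V : Matrix (Fin n) (Fin n) ℂ) * (V : Matrix (Fin n) (Fin n) ℂ) = 1 :=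
      Matrix.mem_unitaryGroup_iff'.1 (hm V)
    have hco : ((U * V⁻¹ : Matrix.unitaryGroup (Fin n) ℂ) : Matrix (Fin n) (Fin n) ℂ)
      = (U : Matrix (Fin n) (Fin n) ℂ) * star (V : Matrix (Fin n) (Fin n) ℂ) := rfl
    constructor
    · intro h
      rw [hd] at h
      obtain ⟨x, hx⟩ := nuStar_attained μ hμ hμ0 _ (hm (U * V⁻¹))
      rw [h] at hx
      have h1 := nu_eq_zero μ hμ hμ0 hμne _ (smul_exp_mem _ (hm _) x) hx
      refine ⟨x, ?_⟩
      rw [hco] at h1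
      have h2 := congrArg (· * (V : Matrix (Fin n) (Fin n) ℂ)) h1
      simp only [smul_mul_assoc, mul_assoc, hV2, mul_one, one_mul] at h2
      exact h2.symm
    · rintro ⟨x, hx⟩
      rw [hd]
      apply hphase x _ (hm _)
      rw [hco, ← smul_mul_assoc, ← hx, hV1]
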